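/- Let G be a cograph with diameter 2 belonging to 𝒢₁(n, n−3) with n ≥ 5. Then G contains no induced subgraph isomorphic to the 5-vertex graph H₁, whose edge set on vertices {v₁, v₂, v₃, v₄, v₅} is {v₁v₂, v₂v₃, v₁v₄, v₂v₄, v₁v₅, v₃v₅, v₄v₅} (so v₁v₃, v₃v₄, v₂v₅ are non-edges). -/

import Mathlib

open Matrix

/-- The normalized Laplacian matrix of a finite simple graph. -/
noncomputable def normLap {V : Type*} [Fintype V] [DecidableEq V] (G : SimpleGraph V) [DecidableRel G.Adj] :
    Matrix V V ℝ :=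
  Matrix.of fun u v =>
    if u = v then 1
    else if G.Adj u v then -1 / Real.sqrt ((G.degree u : ℝ) * (G.degree v : ℝ))
    else 0

/-- The (geometric) multiplicity of `μ` as an eigenvalue of the matrix `M`. -/
noncomputable def eigMult {V : Type*} [Fintype V] [DecidableEq V]
    (M : Matrix V V ℝ) (μ : ℝ) : ℕ :=
  Module.finrank ℝ (LinearMap.ker (M - μ • (1 : Matrix V V ℝ)).mulVecLin)

/-- The multiset of eigenvalues (with multiplicity) of a hermitian matrix. -/
noncomputable def eigMultiset {V : Type*} [Fintype V] [DecidableEq V]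
    (M : Matrix V V ℝ) : Multiset ℝ :=
  if h : M.IsHermitian then Finset.univ.val.map h.eigenvalues else 0

/-- The second-smallest eigenvalue (counted with multiplicity) of a hermitian matrix. -/
noncomputable def secondSmallestEig {V : Type*} [Fintype V] [DecidableEq V]
    (M : Matrix V V ℝ) : ℝ :=
  ((eigMultiset M).sort (· ≤ ·)).getD 1 0

/-- The independence number of a finite simple graph. -/
noncomputable def indepNum {V : Type*} [Fintype V] (G : SimpleGraph V) : ℕ :=
  sSup {k | ∃ s : Finset V, (∀ u ∈ s, ∀ v ∈ s, u ≠ v → ¬ G.Adj u v) ∧ s.card = k}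

/-- `G ∈ 𝒢₁(n, n-3)`. -/
def memG1Family {V : Type*} [Fintype V] [DecidableEq V]
    (G : SimpleGraph V) [DecidableRel G.Adj] (n : ℕ) : Prop :=
  G.Connected ∧ Fintype.card V = n ∧
    (∃ θ : ℝ, eigMult (normLap G) θ = n - 3) ∧
    secondSmallestEig (normLap G) ≠ 1 ∧
    indepNum G = 2

/-- `v₁v₂v₃v₄` is an induced path `P₄`. -/
def IsInducedP4 {V : Type*} (G : SimpleGraph V) (v1 v2 v3 v4 : V) : Prop :=
  G.Adj v1 v2 ∧ G.Adj v2 v3 ∧ G.Adj v3 v4 ∧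
    ¬ G.Adj v1 v3 ∧ ¬ G.Adj v1 v4 ∧ ¬ G.Adj v2 v4

/-- A cograph: no induced path on 4 vertices. -/
def IsCograph {V : Type*} (G : SimpleGraph V) : Prop :=
  ∀ a b c d : V, ¬ IsInducedP4 G a b c d

/-- `S_U`: vertices outside the path `P` whose neighborhood inside `P` is exactly `U`. -/
def Sset {V : Type*} (G : SimpleGraph V) (P U : Set V) : Set V :=
  {u | u ∉ P ∧ G.neighborSet u ∩ P = U}

/-- The graph `G₁`: two cliques `A` (of size `a+1`) and `B` (of size `b+1`) forming a complete
graph together, a vertex `u` joined to all of `A` and a vertex `w` joined to all of `B`. -/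
def graphG1 (a b : ℕ) : SimpleGraph (Unit ⊕ (Fin (a + 1) ⊕ (Fin (b + 1) ⊕ Unit))) :=
  SimpleGraph.fromRel fun x y =>
    match x, y with
    | Sum.inl _, Sum.inr (Sum.inl _) => True
    | Sum.inr (Sum.inl _), Sum.inr (Sum.inl _) => True
    | Sum.inr (Sum.inl _), Sum.inr (Sum.inr (Sum.inl _)) => True
    | Sum.inr (Sum.inr (Sum.inl _)), Sum.inr (Sum.inr (Sum.inl _)) => True
    | Sum.inr (Sum.inr (Sum.inl _)), Sum.inr (Sum.inr (Sum.inr _)) => True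
    | _, _ => False

noncomputable instance (a b : ℕ) : DecidableRel (graphG1 a b).Adj := Classical.decRel _

/-- The graph `G₂` on `m + 2` vertices: a complete graph on `m + 1` vertices together with a
pendant vertex attached to one of its vertices. -/
def graphG2 (m : ℕ) : SimpleGraph (Unit ⊕ Fin (m + 1)) :=
  SimpleGraph.fromRel fun x y =>
    match x, y with
    | Sum.inl _, Sum.inr j => j = 0
    | Sum.inr _, Sum.inr _ => True
    | _, _ => False

noncomputable instance (m : ℕ) : DecidableRel (graphG2 m).Adj := Classical.decRel _

/-- The join of a single vertex with the disjoint union of two complete graphs `K_m`. -/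
def joinTwoCliques (m : ℕ) : SimpleGraph (Unit ⊕ (Fin m ⊕ Fin m)) :=
  SimpleGraph.fromRel fun x y =>
    match x, y with
    | Sum.inl _, Sum.inr _ => True
    | Sum.inr (Sum.inl _), Sum.inr (Sum.inl _) => True
    | Sum.inr (Sum.inr _), Sum.inr (Sum.inr _) => True
    | _, _ => False

noncomputable instance (m : ℕ) : DecidableRel (joinTwoCliques m).Adj := Classical.decRel _

section

variable {V : Type*} [Fintype V]

lemma adj_of_indepNum_eq_two {G : SimpleGraph V} (h : indepNum G = 2) {a b c : V}
    (hab : a ≠ b) (hac : a ≠ c) (hbc : b ≠ c) (nab : ¬ G.Adj a b) (nac : ¬ G.Adj a c) :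
    G.Adj b c := by
  classical
  by_contra nbc
  have hmem : 3 ∈ {k | ∃ s : Finset V, (∀ u ∈ s, ∀ v ∈ s, u ≠ v → ¬ G.Adj u v) ∧ s.card = k} := by
    refine ⟨{a, b, c}, ?_, Finset.card_eq_three.2 ⟨a, b, c, hab, hac, hbc, rfl⟩⟩
    intro u hu v hv huv
    simp only [Finset.mem_insert, Finset.mem_singleton] at hu hv
    rcases hu with rfl | rfl | rfl <;> rcases hv with rfl | rfl | rfl <;>
      simp_all [G.adj_comm]
  have hbdd : BddAbove
      {k | ∃ s : Finset V, (∀ u ∈ s, ∀ v ∈ s, u ≠ v → ¬ G.Adj u v) ∧ s.card = k} := by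
    refine ⟨Fintype.card V, ?_⟩
    rintro k ⟨s, -, rfl⟩
    exact s.card_le_univ
  have : 3 ≤ indepNum G := le_csSup hbdd hmem
  omega

lemma adj_of_adj_of_common_nonneighbor {G : SimpleGraph V} (hα : indepNum G = 2)
    (hco : IsCograph G) {u v x w : V} (huv : u ≠ v) (hux : u ≠ x) (hvx : v ≠ x)
    (nux : ¬ G.Adj u x) (nvx : ¬ G.Adj v x) (hwu : w ≠ u) (h : G.Adj v w) : G.Adj u w := by
  by_contra nuw
  have auv : G.Adj u v := adj_of_indepNum_eq_two hα hux.symm hvx.symm huv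
    (fun h => nux h.symm) (fun h => nvx h.symm)
  have hwx : w ≠ x := by rintro rfl; exact nvx h
  have awx : G.Adj w x :=
    adj_of_indepNum_eq_two hα hwu.symm hux hwx nuw nux
  exact hco u v w x ⟨auv, h, awx, nuw, nux, nvx⟩

variable [DecidableEq V]

lemma degree_le_of_common_nonneighbor {G : SimpleGraph V} [DecidableRel G.Adj]
    (hα : indepNum G = 2)
    (hco : IsCograph G) {u v x : V} (huv : u ≠ v) (hux : u ≠ x) (hvx : v ≠ x)
    (nux : ¬ G.Adj u x) (nvx : ¬ G.Adj v x) : G.degree v ≤ G.degree u := by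
  have auv : G.Adj u v := adj_of_indepNum_eq_two hα hux.symm hvx.symm huv
    (fun h => nux h.symm) (fun h => nvx h.symm)
  have hsub : (G.neighborFinset v).erase u ⊆ (G.neighborFinset u).erase v := by
    intro w hw
    simp only [Finset.mem_erase, SimpleGraph.mem_neighborFinset] at hw ⊢
    exact ⟨hw.2.ne', adj_of_adj_of_common_nonneighbor hα hco huv hux hvx nux nvx hw.1 hw.2⟩
  have hcard := Finset.card_le_card hsub
  rw [Finset.card_erase_of_mem (by simpa using auv.symm),
    Finset.card_erase_of_mem (by simpa using auv)] at hcard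
  simp only [SimpleGraph.card_neighborFinset_eq_degree] at hcard
  have : 0 < G.degree u := (G.degree_pos_iff_exists_adj u).2 ⟨v, auv⟩
  omega

lemma degree_add_two_le_card {G : SimpleGraph V} [DecidableRel G.Adj] {u v : V} (huv : u ≠ v)
    (h : ¬ G.Adj u v) : G.degree u + 2 ≤ Fintype.card V := by
  have hsub : G.neighborFinset u ⊆ Finset.univ \ {u, v} := by
    intro w hw
    simp only [SimpleGraph.mem_neighborFinset] at hw
    simp only [Finset.mem_sdiff, Finset.mem_univ, true_and, Finset.mem_insert,
      Finset.mem_singleton, not_or]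
    exact ⟨hw.ne', by rintro rfl; exact h hw⟩
  have hcard := Finset.card_le_card hsub
  have := Finset.card_sdiff_add_card_eq_card (Finset.subset_univ ({u, v} : Finset V))
  rw [Finset.card_pair huv, Finset.card_univ] at this
  rw [SimpleGraph.card_neighborFinset_eq_degree] at hcard
  omega

/-- The matrix `A + t D`, congruent up to sign to `ℒ - (1 + t) I`. -/
noncomputable def adjAddSmulDegree (G : SimpleGraph V) [DecidableRel G.Adj] (t : ℝ) :
    Matrix V V ℝ :=
  Matrix.of fun u v => if u = v then t * G.degree u else if G.Adj u v then 1 else 0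

lemma adjAddSmulDegree_eq {G : SimpleGraph V} [DecidableRel G.Adj] (θ : ℝ)
    (hpos : ∀ v, 0 < G.degree v) :
    adjAddSmulDegree G (θ - 1) = Matrix.diagonal (fun v => -√(G.degree v : ℝ)) *
      (normLap G - θ • 1) * Matrix.diagonal (fun v => √(G.degree v : ℝ)) := by
  ext u v
  have hu : 0 < √(G.degree u : ℝ) := Real.sqrt_pos.2 (by exact_mod_cast hpos u)
  have hv : 0 < √(G.degree v : ℝ) := Real.sqrt_pos.2 (by exact_mod_cast hpos v)
  rw [Matrix.mul_diagonal, Matrix.diagonal_mul]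
  by_cases huv : u = v
  · subst huv
    have hs := Real.mul_self_sqrt (Nat.cast_nonneg (α := ℝ) (G.degree u))
    simp only [adjAddSmulDegree, normLap, Matrix.of_apply, Matrix.sub_apply, Matrix.smul_apply,
      Matrix.one_apply_eq, if_true, smul_eq_mul, mul_one]
    linear_combination (1 - θ) * hs
  · by_cases h : G.Adj u v
    · simp only [adjAddSmulDegree, normLap, Matrix.of_apply, Matrix.sub_apply, Matrix.smul_apply,
        Matrix.one_apply_ne huv, if_neg huv, if_pos h, smul_zero, sub_zero]
      rw [Real.sqrt_mul (Nat.cast_nonneg _)]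
      field_simp
    · simp [adjAddSmulDegree, normLap, huv, h]

lemma rank_add_eigMult (M : Matrix V V ℝ) (μ : ℝ) :
    (M - μ • (1 : Matrix V V ℝ)).rank + eigMult M μ = Fintype.card V := by
  have := (M - μ • (1 : Matrix V V ℝ)).mulVecLin.finrank_range_add_finrank_ker
  rwa [Module.finrank_fintype_fun_eq_card] at this

lemma det_submatrix_eq_zero_of_rank_lt {k : ℕ} {N : Matrix V V ℝ} (h : N.rank < k)
    (f g : Fin k → V) : (N.submatrix f g).det = 0 := by
  by_contra hdet
  have hfull := Matrix.rank_of_isUnit (N.submatrix f g)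
    ((Matrix.isUnit_iff_isUnit_det _).2 (isUnit_iff_ne_zero.2 hdet))
  have heq : N.submatrix f g =
      (1 : Matrix V V ℝ).submatrix f id * N * (1 : Matrix V V ℝ).submatrix id g := by
    ext i j
    simp [Matrix.mul_apply, Matrix.one_apply]
  have hle : (N.submatrix f g).rank ≤ N.rank := by
    rw [heq]
    exact (Matrix.rank_mul_le_left _ _).trans (Matrix.rank_mul_le_right _ _)
  rw [hfull, Fintype.card_fin] at hle
  omega

lemma det_fin_four {R : Type*} [CommRing R] (M : Matrix (Fin 4) (Fin 4) R) :
    M.det =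
      M 0 0 * (M 1 1 * (M 2 2 * M 3 3 - M 2 3 * M 3 2) - M 1 2 * (M 2 1 * M 3 3 - M 2 3 * M 3 1) +
        M 1 3 * (M 2 1 * M 3 2 - M 2 2 * M 3 1)) -
      M 0 1 * (M 1 0 * (M 2 2 * M 3 3 - M 2 3 * M 3 2) - M 1 2 * (M 2 0 * M 3 3 - M 2 3 * M 3 0) +
        M 1 3 * (M 2 0 * M 3 2 - M 2 2 * M 3 0)) +
      M 0 2 * (M 1 0 * (M 2 1 * M 3 3 - M 2 3 * M 3 1) - M 1 1 * (M 2 0 * M 3 3 - M 2 3 * M 3 0) +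
        M 1 3 * (M 2 0 * M 3 1 - M 2 1 * M 3 0)) -
      M 0 3 * (M 1 0 * (M 2 1 * M 3 2 - M 2 2 * M 3 1) - M 1 1 * (M 2 0 * M 3 2 - M 2 2 * M 3 0) +
        M 1 2 * (M 2 0 * M 3 1 - M 2 1 * M 3 0)) := by
  rw [Matrix.det_succ_row_zero]
  simp only [Fin.sum_univ_four, Matrix.det_fin_three, Matrix.submatrix_apply]
  simp [Fin.succAbove, Fin.lt_def]
  ring

/-- Vanishing of the `4 × 4` minors on an induced copy of `H₁` whose adjacent vertices
`u, v` have the same degree. -/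
lemma minors_of_induced {G : SimpleGraph V} [DecidableRel G.Adj] {t : ℝ}
    (hpos : ∀ v, 0 < G.degree v) (hrank : (adjAddSmulDegree G t).rank < 4) {u v x y z : V}
    (hdeg : G.degree v = G.degree u) (huv : G.Adj u v)
    (hux : u ≠ x) (hvx : v ≠ x) (hyz : y ≠ z)
    (nux : ¬ G.Adj u x) (nvx : ¬ G.Adj v x) (nyz : ¬ G.Adj y z)
    (huy : G.Adj u y) (huz : G.Adj u z) (hvy : G.Adj v y) (hvz : G.Adj v z)
    (hxy : G.Adj x y) (hxz : G.Adj x z) :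
    t * G.degree u = 1 ∧
      t * G.degree x * (t * G.degree y * (t * G.degree z) - t * G.degree y - t * G.degree z) =
        t * G.degree y + t * G.degree z := by
  have nxu : ¬ G.Adj x u := fun h => nux h.symm
  have nxv : ¬ G.Adj x v := fun h => nvx h.symm
  have nzy : ¬ G.Adj z y := fun h => nyz h.symm
  have h₁ := det_submatrix_eq_zero_of_rank_lt hrank ![u, v, y, x] ![u, v, y, z]
  have h₂ := det_submatrix_eq_zero_of_rank_lt hrank ![u, v, y, x] ![u, v, y, x]
  have h₃ := det_submatrix_eq_zero_of_rank_lt hrank ![u, y, z, x] ![u, y, z, x]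
  rw [det_fin_four] at h₁ h₂ h₃
  simp [adjAddSmulDegree, hdeg,
    huv, huv.symm, huv.ne, huv.ne', hux, hux.symm, hvx, hvx.symm, hyz, hyz.symm, nux, nxu, nvx,
    nxv, nyz, nzy, huy, huy.symm, huy.ne, huy.ne', huz, huz.symm, huz.ne, huz.ne', hvy, hvy.symm,
    hvy.ne, hvy.ne', hvz, hvz.ne, hxy, hxy.symm, hxy.ne, hxy.ne', hxz,
    hxz.symm, hxz.ne, hxz.ne'] at h₁ h₂ h₃
  have pu : (G.degree u : ℝ) ≠ 0 := by exact_mod_cast (hpos u).ne'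
  have px : (G.degree x : ℝ) ≠ 0 := by exact_mod_cast (hpos x).ne'
  have py : (G.degree y : ℝ) ≠ 0 := by exact_mod_cast (hpos y).ne'
  generalize (G.degree u : ℝ) = a at *
  generalize (G.degree x : ℝ) = b at *
  generalize (G.degree y : ℝ) = c at *
  generalize (G.degree z : ℝ) = d at *
  have hu : t * a = 1 := by
    by_contra hne
    have hne : t * a - 1 ≠ 0 := sub_ne_zero.2 hne
    have e₁ : (t * a + 1) * (t * c) = 0 :=
      (mul_eq_zero.1 (by linear_combination h₁ :
        (t * a - 1) * ((t * a + 1) * (t * c)) = 0)).resolve_left hne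
    have e₂ : t * b * ((t * a + 1) * (t * c) - 2) - (t * a + 1) = 0 :=
      (mul_eq_zero.1 (by linear_combination h₂ :
        (t * a - 1) * (t * b * ((t * a + 1) * (t * c) - 2) - (t * a + 1)) = 0)).resolve_left hne
    have ht : t ≠ 0 := by rintro rfl; simp at e₂
    have e₃ : t * a + 1 = 0 := (mul_eq_zero.1 e₁).resolve_right (mul_ne_zero ht py)
    have e₄ : t * b = 0 := by linear_combination (-e₂ + (t * b) * e₁ - e₃) / 2
    exact mul_ne_zero ht px e₄
  refine ⟨hu, ?_⟩
  rw [hu] at h₃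
  linear_combination h₃

end

theorem statement12 {V : Type*} [Fintype V] [DecidableEq V] (n : ℕ) (hn : 5 ≤ n)
    (G : SimpleGraph V) [DecidableRel G.Adj]
    (hG : memG1Family G n) (hco : IsCograph G) (hdiam : G.diam = 2) :
    ¬ ∃ w1 w2 w3 w4 w5 : V,
      w1 ≠ w2 ∧ w1 ≠ w3 ∧ w1 ≠ w4 ∧ w1 ≠ w5 ∧ w2 ≠ w3 ∧ w2 ≠ w4 ∧ w2 ≠ w5 ∧
      w3 ≠ w4 ∧ w3 ≠ w5 ∧ w4 ≠ w5 ∧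
      G.Adj w1 w2 ∧ G.Adj w2 w3 ∧ G.Adj w1 w4 ∧ G.Adj w2 w4 ∧
      G.Adj w1 w5 ∧ G.Adj w3 w5 ∧ G.Adj w4 w5 ∧
      ¬ G.Adj w1 w3 ∧ ¬ G.Adj w3 w4 ∧ ¬ G.Adj w2 w5 := by
  rintro ⟨w1, w2, w3, w4, w5, -, h13, -, -, -, -, h25, h34, -, -, a12, a23, a14, a24, a15, a35,
    a45, n13, n34, n25⟩
  obtain ⟨hconn, hcard, ⟨θ, hθ⟩, -, hα⟩ := hG
  have : Nontrivial V := ⟨w1, w3, h13⟩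
  have hpos : ∀ v, 0 < G.degree v := fun v => hconn.preconnected.degree_pos_of_nontrivial v
  have hrank : (adjAddSmulDegree G (θ - 1)).rank < 4 := by
    have h := rank_add_eigMult (normLap G) θ
    have hle : (adjAddSmulDegree G (θ - 1)).rank ≤ (normLap G - θ • (1 : Matrix V V ℝ)).rank := by
      rw [adjAddSmulDegree_eq θ hpos]
      exact (Matrix.rank_mul_le_left _ _).trans (Matrix.rank_mul_le_right _ _)
    omega
  have n43 : ¬ G.Adj w4 w3 := fun h => n34 h.symm
  have n31 : ¬ G.Adj w3 w1 := fun h => n13 h.symm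
  have d41 : G.degree w4 = G.degree w1 := le_antisymm
    (degree_le_of_common_nonneighbor hα hco a14.ne h13 h34.symm n13 n43)
    (degree_le_of_common_nonneighbor hα hco a14.ne' h34.symm h13 n43 n13)
  obtain ⟨ht, heq⟩ := minors_of_induced hpos hrank d41 a14 h13 h34.symm h25 n13 n43 n25 a12 a15
    a24.symm a45 a23.symm a35
  have d2 := degree_add_two_le_card h25 n25
  have d5 := degree_add_two_le_card h25.symm (fun h => n25 h.symm)
  have hlarge : Fintype.card V ≤ 2 * G.degree w1 := by
    by_cases hex : ∃ v, v ≠ w1 ∧ v ≠ w3 ∧ ¬ G.Adj v w1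
    · obtain ⟨v, hv1, hv3, nv1⟩ := hex
      have av3 : G.Adj w3 v := adj_of_indepNum_eq_two hα h13 hv1.symm hv3.symm n13
        (fun h => nv1 h.symm)
      have dv3 : G.degree v = G.degree w3 := le_antisymm
        (degree_le_of_common_nonneighbor hα hco hv3.symm h13.symm hv1 n31 nv1)
        (degree_le_of_common_nonneighbor hα hco hv3 hv1 h13.symm nv1 n31)
      have hv2 : v ≠ w2 := by rintro rfl; exact nv1 a12.symm
      have hv5 : v ≠ w5 := by rintro rfl; exact nv1 a15.symm
      have av2 : G.Adj v w2 := adj_of_adj_of_common_nonneighbor hα hco hv3 hv1 h13.symm nv1 n31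
        hv2.symm a23.symm
      have av5 : G.Adj v w5 := adj_of_adj_of_common_nonneighbor hα hco hv3 hv1 h13.symm nv1 n31
        hv5.symm a35
      have ht' := (minors_of_induced hpos hrank dv3 av3 h13.symm hv1 h25 n31 nv1 n25 a23.symm a35
        av2 av5 a12 a15).1
      have ht0 : θ - 1 ≠ 0 := left_ne_zero_of_mul_eq_one ht
      have d13 : G.degree w1 = G.degree w3 := by
        exact_mod_cast mul_left_cancel₀ ht0 (ht.trans ht'.symm)
      have hunion : Finset.univ \ {w1, w3} ⊆ G.neighborFinset w1 ∪ G.neighborFinset w3 := by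
        intro w hw
        simp only [Finset.mem_sdiff, Finset.mem_univ, true_and, Finset.mem_insert,
          Finset.mem_singleton, not_or] at hw
        simp only [Finset.mem_union, SimpleGraph.mem_neighborFinset]
        by_contra! h
        exact h.2 (adj_of_indepNum_eq_two hα h13 (Ne.symm hw.1) (Ne.symm hw.2)
          n13 h.1)
      have hinter : {w2, w5} ⊆ G.neighborFinset w1 ∩ G.neighborFinset w3 := by
        simp [Finset.insert_subset_iff, a12, a15, a23.symm, a35]
      have c₁ := Finset.card_le_card hunion
      have c₂ := Finset.card_le_card hinter
      have c₃ := Finset.card_union_add_card_inter (G.neighborFinset w1) (G.neighborFinset w3)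
      have c₄ := Finset.card_sdiff_add_card_eq_card (Finset.subset_univ ({w1, w3} : Finset V))
      rw [Finset.card_pair h13, Finset.card_univ] at c₄
      rw [Finset.card_pair h25] at c₂
      simp only [SimpleGraph.card_neighborFinset_eq_degree] at c₃
      omega
    · push Not at hex
      have hsub : Finset.univ \ {w1, w3} ⊆ G.neighborFinset w1 := by
        intro w hw
        simp only [Finset.mem_sdiff, Finset.mem_univ, true_and, Finset.mem_insert,
          Finset.mem_singleton, not_or] at hw
        simpa using (hex w hw.1 hw.2).symm
      have c₁ := Finset.card_le_card hsub
      have c₄ := Finset.card_sdiff_add_card_eq_card (Finset.subset_univ ({w1, w3} : Finset V))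
      rw [Finset.card_pair h13, Finset.card_univ] at c₄
      rw [SimpleGraph.card_neighborFinset_eq_degree] at c₁
      omega
  have p1 : (0 : ℝ) < G.degree w1 := by exact_mod_cast hpos w1
  have p2 : (0 : ℝ) < G.degree w2 := by exact_mod_cast hpos w2
  have p3 : (0 : ℝ) < G.degree w3 := by exact_mod_cast hpos w3
  have p5 : (0 : ℝ) < G.degree w5 := by exact_mod_cast hpos w5
  have htpos : 0 < θ - 1 := by
    by_contra! h
    nlinarith
  have l2 : (θ - 1) * G.degree w2 < 2 := by
    have : (G.degree w2 : ℝ) < 2 * G.degree w1 := by exact_mod_cast (by omega)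
    nlinarith
  have l5 : (θ - 1) * G.degree w5 < 2 := by
    have : (G.degree w5 : ℝ) < 2 * G.degree w1 := by exact_mod_cast (by omega)
    nlinarith
  have q2 := mul_pos htpos p2
  have q3 := mul_pos htpos p3
  have q5 := mul_pos htpos p5
  generalize (θ - 1) * (G.degree w2 : ℝ) = y at *
  generalize (θ - 1) * (G.degree w5 : ℝ) = z at *
  have hneg : y * z - y - z < 0 := by
    linear_combination (mul_pos q2 (sub_pos.2 l5)) / 2 + (mul_pos q5 (sub_pos.2 l2)) / 2
  have := mul_neg_of_pos_of_neg q3 hneg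
  linarith
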